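/- Let (W,S) be a finite Coxeter system with longest element w₀. Then Σ_{J ⊆ S} (-1)^{|J|} D_J = (-1)^{l(w₀)}, where l(w₀) equals the number of reflections of W (elements of the form wsw⁻¹ with w ∈ W, s ∈ S). -/

import Mathlib

open scoped Classical Pointwise

variable {B : Type*} [Fintype B]
variable {W : Type*} [Group W] [Fintype W]
variable {M : CoxeterMatrix B}

/-- The standard parabolic subgroup `W_J` of the Coxeter system `cs`,
generated by the simple reflections indexed by `J`. -/
def CoxParabolic (cs : CoxeterSystem M W) (J : Finset B) : Subgroup W :=
  Subgroup.closure (cs.simple '' ↑J)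

/-- The set `X_J` of distinguished (minimal length) left coset representatives
of `W_J` in `W`: the elements `w` with `l (w * s) > l w` for all simple `s` in `J`. -/
noncomputable def CoxX (cs : CoxeterSystem M W) (J : Finset B) : Finset W :=
  Finset.univ.filter fun w => ∀ j ∈ J, cs.length w < cs.length (w * cs.simple j)

/-- `D_J = Σ_{w ∈ X_J} (-1)^{l(w)}`. -/
noncomputable def CoxD (cs : CoxeterSystem M W) (J : Finset B) : ℤ :=
  ∑ w ∈ CoxX cs J, (-1) ^ cs.length w

namespace CoxeterSystem

section ReflectionCocycle

variable {ι G : Type*} [Group G] {C : CoxeterMatrix ι} (cs : CoxeterSystem C G)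

theorem _root_.Function.End.mul_apply {α : Type*} (f g : Function.End α) (x : α) :
    (f * g) x = f (g x) := rfl

theorem _root_.Function.End.one_apply {α : Type*} (x : α) : (1 : Function.End α) x = x := rfl

/-- The action of the simple reflection `s i` on `G × ZMod 2`: conjugation on the first factor,
with the sign flipped exactly at `s i`. -/
noncomputable def signedConj (i : ι) : Function.End (G × ZMod 2) := fun p =>
  (cs.simple i * p.1 * cs.simple i, p.2 + if p.1 = cs.simple i then 1 else 0)

theorem signedConj_mul_pow_apply (i j : ι) (k : ℕ) (t : G) (ε : ZMod 2) :
    ((cs.signedConj i * cs.signedConj j) ^ k : Function.End (G × ZMod 2)) (t, ε) =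
      ((cs.simple i * cs.simple j) ^ k * t * (cs.simple j * cs.simple i) ^ k,
        ε + ∑ l ∈ Finset.range (2 * k),
          if t = (cs.simple j * cs.simple i) ^ l * cs.simple j then 1 else 0) := by
  have hinv : ∀ n : ℕ, ((cs.simple i * cs.simple j) ^ n)⁻¹ = (cs.simple j * cs.simple i) ^ n :=
    fun n => by rw [← inv_pow, mul_inv_rev, cs.inv_simple, cs.inv_simple]
  have hcomm : ∀ n : ℕ, cs.simple j * (cs.simple i * cs.simple j) ^ n =
      (cs.simple j * cs.simple i) ^ n * cs.simple j := fun n =>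
    SemiconjBy.pow_right (x := cs.simple i * cs.simple j) (y := cs.simple j * cs.simple i)
      (mul_assoc _ _ _).symm n
  induction k with
  | zero => simp [Function.End.one_apply]
  | succ k ih =>
    have hleft : (cs.simple i * cs.simple j) ^ k * t * (cs.simple j * cs.simple i) ^ k =
        cs.simple j ↔ t = (cs.simple j * cs.simple i) ^ (2 * k) * cs.simple j := by
      rw [← hinv k, mul_inv_eq_iff_eq_mul, hcomm, ← eq_inv_mul_iff_mul_eq, hinv, ← mul_assoc,
        ← pow_add, two_mul]
    have hright : cs.simple j * ((cs.simple i * cs.simple j) ^ k * t *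
        (cs.simple j * cs.simple i) ^ k) * cs.simple j = cs.simple i ↔
        t = (cs.simple j * cs.simple i) ^ (2 * k + 1) * cs.simple j := by
      have h : ∀ x : G, cs.simple j * x * cs.simple j = cs.simple i ↔
          x = cs.simple j * cs.simple i * cs.simple j := fun x => by
        constructor
        · intro h
          simp [← h, mul_assoc]
        · rintro rfl
          simp [mul_assoc]
      rw [h, ← hinv k, mul_inv_eq_iff_eq_mul, mul_assoc _ (cs.simple j), hcomm,
        ← eq_inv_mul_iff_mul_eq, hinv, ← mul_assoc, ← mul_assoc, ← pow_succ, ← pow_add,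
        show k + 1 + k = 2 * k + 1 by ring]
    rw [pow_succ', Function.End.mul_apply, ih, Function.End.mul_apply]
    simp only [signedConj]
    rw [Prod.mk.injEq]
    constructor
    · rw [pow_succ', pow_succ]
      simp only [mul_assoc]
    · rw [show 2 * (k + 1) = 2 * k + 1 + 1 by ring, Finset.sum_range_succ, Finset.sum_range_succ]
      simp only [hleft, hright, add_assoc]

theorem isLiftable_signedConj : C.IsLiftable cs.signedConj := by
  intro i j
  funext ⟨t, ε⟩
  have hij : (cs.simple i * cs.simple j) ^ C i j = 1 := cs.simple_mul_simple_pow i j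
  have hji : (cs.simple j * cs.simple i) ^ C i j = 1 := cs.simple_mul_simple_pow' i j
  rw [signedConj_mul_pow_apply, hij, hji, two_mul, Finset.sum_range_add]
  simp only [pow_add, hji, one_mul, mul_one, CharTwo.add_self_eq_zero, add_zero]
  rfl

/-- The parity of the number of occurrences of `t` in the right inversion sequence of any word
for `w`; see `inversionParity_wordProd`. -/
noncomputable def inversionParity (w t : G) : ZMod 2 :=
  (cs.lift ⟨cs.signedConj, cs.isLiftable_signedConj⟩ w (t, 0)).2

theorem lift_signedConj_wordProd (ω : List ι) (t : G) (ε : ZMod 2) :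
    cs.lift ⟨cs.signedConj, cs.isLiftable_signedConj⟩ (cs.wordProd ω) (t, ε) =
      (cs.wordProd ω * t * (cs.wordProd ω)⁻¹, ε + ((cs.rightInvSeq ω).count t : ZMod 2)) := by
  induction ω with
  | nil => simp [Function.End.one_apply]
  | cons i ω ih =>
    rw [cs.wordProd_cons, map_mul, Function.End.mul_apply, ih, lift_apply_simple]
    have h : cs.wordProd ω * t * (cs.wordProd ω)⁻¹ = cs.simple i ↔
        (cs.wordProd ω)⁻¹ * cs.simple i * cs.wordProd ω = t := by
      rw [mul_inv_eq_iff_eq_mul, mul_assoc _ (cs.simple i), inv_mul_eq_iff_eq_mul, eq_comm]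
    simp only [signedConj, rightInvSeq, List.count_cons, h, beq_iff_eq]
    simp [mul_assoc, add_assoc]

theorem inversionParity_wordProd (ω : List ι) (t : G) :
    cs.inversionParity (cs.wordProd ω) t = ((cs.rightInvSeq ω).count t : ZMod 2) := by
  simp [inversionParity, lift_signedConj_wordProd]

theorem inversionParity_mul (u v t : G) :
    cs.inversionParity (u * v) t =
      cs.inversionParity v t + cs.inversionParity u (v * t * v⁻¹) := by
  obtain ⟨ω, rfl⟩ := cs.wordProd_surjective u
  obtain ⟨ω', rfl⟩ := cs.wordProd_surjective v
  rw [inversionParity, map_mul, Function.End.mul_apply, lift_signedConj_wordProd,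
    lift_signedConj_wordProd, inversionParity_wordProd, inversionParity_wordProd, zero_add]

theorem inversionParity_simple (i : ι) : cs.inversionParity (cs.simple i) (cs.simple i) = 1 := by
  simpa using cs.inversionParity_wordProd [i] (cs.simple i)

theorem inversionParity_one (t : G) : cs.inversionParity 1 t = 0 := by
  simpa using cs.inversionParity_wordProd [] t

theorem IsReflection.inversionParity_self {cs : CoxeterSystem C G} {t : G}
    (ht : cs.IsReflection t) : cs.inversionParity t t = 1 := by
  obtain ⟨w, i, rfl⟩ := ht
  rw [inversionParity_mul, inversionParity_mul]
  have h₁ : w⁻¹ * (w * cs.simple i * w⁻¹) * w⁻¹⁻¹ = cs.simple i := by group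
  have h₂ : cs.simple i * cs.simple i * (cs.simple i)⁻¹ = cs.simple i := by group
  have hw := cs.inversionParity_mul w w⁻¹ (w * cs.simple i * w⁻¹)
  rw [mul_inv_cancel, inversionParity_one, h₁] at hw
  rw [h₁, h₂, inversionParity_simple, add_left_comm, ← hw, add_zero]

theorem mem_rightInvSeq_of_inversionParity {ω : List ι} {t : G}
    (h : cs.inversionParity (cs.wordProd ω) t = 1) : t ∈ cs.rightInvSeq ω := by
  by_contra hmem
  rw [inversionParity_wordProd, List.count_eq_zero_of_not_mem hmem] at h
  simp at h

theorem length_mul_lt_of_inversionParity {w t : G} (h : cs.inversionParity w t = 1) :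
    cs.length (w * t) < cs.length w := by
  obtain ⟨ω, hω, rfl⟩ := cs.exists_isReduced w
  exact (cs.isRightInversion_of_mem_rightInvSeq hω (cs.mem_rightInvSeq_of_inversionParity h)).2

theorem IsReflection.length_mul_lt_iff {cs : CoxeterSystem C G} {t : G} (ht : cs.IsReflection t)
    (w : G) : cs.length (w * t) < cs.length w ↔ cs.inversionParity w t = 1 := by
  refine ⟨fun hlt => ?_, cs.length_mul_lt_of_inversionParity⟩
  by_contra h
  have h0 : cs.inversionParity w t = 0 := by
    generalize cs.inversionParity w t = x at h
    fin_cases x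
    · rfl
    · exact absurd rfl h
  have h1 : cs.inversionParity (w * t) t = 1 := by
    rw [inversionParity_mul, ht.inversionParity_self, mul_inv_cancel_right, h0, add_zero]
  have := cs.length_mul_lt_of_inversionParity h1
  rw [mul_assoc, ht.mul_self, mul_one] at this
  exact lt_asymm hlt this

theorem ncard_isRightInversion (w : G) : {t | cs.IsRightInversion w t}.ncard = cs.length w := by
  obtain ⟨ω, hω, rfl⟩ := cs.exists_isReduced w
  have hset : {t | cs.IsRightInversion (cs.wordProd ω) t} = ↑(cs.rightInvSeq ω).toFinset := by
    ext t
    simp only [Set.mem_ofPred_eq, List.coe_toFinset]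
    exact ⟨fun h => cs.mem_rightInvSeq_of_inversionParity ((h.1.length_mul_lt_iff _).1 h.2),
      cs.isRightInversion_of_mem_rightInvSeq hω⟩
  rw [hset, Set.ncard_coe_finset, List.toFinset_card_of_nodup hω.nodup_rightInvSeq,
    cs.length_rightInvSeq, hω.eq]

theorem isRightInversion_of_forall_length_le {w₀ : G} (hw₀ : ∀ w, cs.length w ≤ cs.length w₀)
    {t : G} (ht : cs.IsReflection t) : cs.IsRightInversion w₀ t :=
  ⟨ht, lt_of_le_of_ne (hw₀ _) (ht.length_mul_left_ne w₀)⟩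

theorem eq_of_forall_isRightDescent {w₀ : G} (hw₀ : ∀ w, cs.length w ≤ cs.length w₀) {w : G}
    (hw : ∀ i, cs.IsRightDescent w i) : w = w₀ := by
  by_contra hne
  obtain ⟨i, hi⟩ := cs.exists_rightDescent_of_ne_one
    (show w₀⁻¹ * w ≠ 1 from fun h => hne (inv_mul_eq_one.1 h).symm)
  have hs := cs.isReflection_simple i
  have h := cs.inversionParity_mul w₀ (w₀⁻¹ * w) (cs.simple i)
  rw [mul_inv_cancel_left, (hs.length_mul_lt_iff _).1 (hw i), (hs.length_mul_lt_iff _).1 hi,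
    ((hs.conj _).length_mul_lt_iff _).1
      (cs.isRightInversion_of_forall_length_le hw₀ (hs.conj _)).2] at h
  exact absurd h (by decide)

end ReflectionCocycle

end CoxeterSystem

/-- `Σ_{J ⊆ S} (-1)^{|J|} D_J = (-1)^{l(w₀)}`, where `l(w₀)` equals the number
of reflections of `W` (the elements of the form `w * s * w⁻¹`, `s` simple). -/
theorem alternating_sum_coxD (cs : CoxeterSystem M W) (w₀ : W)
    (hw₀ : ∀ w : W, cs.length w ≤ cs.length w₀) :
    (∑ J : Finset B, (-1 : ℤ) ^ J.card * CoxD cs J = (-1) ^ cs.length w₀) ∧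
      cs.length w₀ = Set.ncard {t : W | ∃ w : W, ∃ i : B, t = w * cs.simple i * w⁻¹} := by
  constructor
  · have hinner : ∀ w : W, (∑ J : Finset B,
        if ∀ j ∈ J, cs.length w < cs.length (w * cs.simple j) then (-1 : ℤ) ^ J.card else 0) =
        if w = w₀ then 1 else 0 := by
      intro w
      have hfilter : (Finset.univ.filter fun J : Finset B =>
          ∀ j ∈ J, cs.length w < cs.length (w * cs.simple j)) =
          (Finset.univ.filter fun j => cs.length w < cs.length (w * cs.simple j)).powerset := by
        ext J
        simp [Finset.subset_iff]
      rw [← Finset.sum_filter, hfilter, Finset.sum_powerset_neg_one_pow_card]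
      congr 1
      rw [Finset.filter_eq_empty_iff, eq_iff_iff]
      constructor
      · intro h
        exact cs.eq_of_forall_isRightDescent hw₀ fun i =>
          lt_of_le_of_ne (not_lt.1 (h (Finset.mem_univ i))) (cs.length_mul_simple_ne w i)
      · rintro rfl i -
        exact not_lt.2 (hw₀ _)
    calc ∑ J : Finset B, (-1 : ℤ) ^ J.card * CoxD cs J
        = ∑ J : Finset B, ∑ w : W, (-1) ^ cs.length w *
            if ∀ j ∈ J, cs.length w < cs.length (w * cs.simple j)
              then (-1 : ℤ) ^ J.card else 0 := by
          refine Finset.sum_congr rfl fun J _ => ?_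
          rw [CoxD, CoxX, Finset.sum_filter, Finset.mul_sum]
          refine Finset.sum_congr rfl fun w _ => ?_
          split_ifs <;> ring
      _ = (-1) ^ cs.length w₀ := by
          rw [Finset.sum_comm]
          simp_rw [← Finset.mul_sum, hinner]
          simp
  · rw [← cs.ncard_isRightInversion w₀]
    congr 1
    ext t
    exact ⟨fun h => h.1, cs.isRightInversion_of_forall_length_le hw₀⟩
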